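/- arXiv:1811.12083 — 4 statements merged into one kernel-verified Lean document; each statement's English description precedes it below -/
import Mathlib

section
/- Let 𝒜 = {A₁,…,A_n} be a finite set of arguments and let 𝒞 = {∑_{i=1}^n c⁽ʲ⁾_i·π(A_i) ≤ c⁽ʲ⁾₀ : 1 ≤ j ≤ m} be a finite set of linear atomic constraints. Consider the linear program: minimize ∑_{j=1}^m s_j over (x,s) ∈ ℝ^{n+m} subject to ∑_{i=1}^n c⁽ʲ⁾_i·x_i ≤ c⁽ʲ⁾₀ + s_j for 1 ≤ j ≤ m, 0 ≤ x_i ≤ 1 for all i, and s_j ≥ 0 for all j. Then the feasible region is nonempty, the infimum of the objective over the feasible region is attained and is ≥ 0, and this minimum equals 0 if and only if 𝒞 is satisfiable by a probability function over 𝒜. -/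
open Finset

/-- A probability function over a finite set of arguments. -/
def IsProbFun {α : Type*} [Fintype α] [DecidableEq α] (P : Finset α → ℝ) : Prop :=
  (∀ w, 0 ≤ P w ∧ P w ≤ 1) ∧ ∑ w : Finset α, P w = 1

/-- The probability of an argument under a probability function. -/
def argProb {α : Type*} [Fintype α] [DecidableEq α] (P : Finset α → ℝ) (a : α) : ℝ :=
  ∑ w ∈ univ.filter (fun w : Finset α => a ∈ w), P w

/-- The feasible region of the linear program for satisfiability: `(x,s)` is feasible iff
`0 ≤ xᵢ ≤ 1`, `sⱼ ≥ 0`, and `∑ᵢ c⁽ʲ⁾ᵢ·xᵢ ≤ c⁽ʲ⁾₀ + sⱼ` for all `j`. -/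
def Feas (n m : ℕ) (c : Fin m → Fin n → ℝ) (c₀ : Fin m → ℝ)
    (p : (Fin n → ℝ) × (Fin m → ℝ)) : Prop :=
  (∀ i, 0 ≤ p.1 i ∧ p.1 i ≤ 1) ∧ (∀ j, 0 ≤ p.2 j) ∧
    ∀ j, ∑ i, c j i * p.1 i ≤ c₀ j + p.2 j

theorem IsProbFun.argProb_nonneg {α : Type*} [Fintype α] [DecidableEq α] {P : Finset α → ℝ}
    (hP : IsProbFun P) (a : α) : 0 ≤ argProb P a :=
  sum_nonneg fun w _ => (hP.1 w).1

theorem IsProbFun.argProb_le_one {α : Type*} [Fintype α] [DecidableEq α] {P : Finset α → ℝ}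
    (hP : IsProbFun P) (a : α) : argProb P a ≤ 1 :=
  hP.2 ▸ sum_le_sum_of_subset_of_nonneg (filter_subset _ _) fun w _ _ => (hP.1 w).1

theorem sum_prod_mul_prod_sdiff {α : Type*} [Fintype α] [DecidableEq α] (f g : α → ℝ) :
    ∑ w : Finset α, (∏ a ∈ w, f a) * ∏ a ∈ univ \ w, g a = ∏ a, (f a + g a) := by
  rw [prod_add, powerset_univ]

/-- The probability function under which the arguments are independent with marginals `x`. -/
def indepProb {α : Type*} [Fintype α] [DecidableEq α] (x : α → ℝ) (w : Finset α) : ℝ :=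
  (∏ a ∈ w, x a) * ∏ a ∈ univ \ w, (1 - x a)

theorem isProbFun_indepProb {α : Type*} [Fintype α] [DecidableEq α] {x : α → ℝ}
    (hx : ∀ a, 0 ≤ x a ∧ x a ≤ 1) : IsProbFun (indepProb x) := by
  have h0 : ∀ w, 0 ≤ indepProb x w := fun w =>
    mul_nonneg (prod_nonneg fun a _ => (hx a).1)
      (prod_nonneg fun a _ => sub_nonneg.2 (hx a).2)
  have h1 : ∑ w : Finset α, indepProb x w = 1 := by
    simp only [indepProb, sum_prod_mul_prod_sdiff, add_sub_cancel, prod_const_one]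
  exact ⟨fun w => ⟨h0 w, h1 ▸ single_le_sum (fun v _ => h0 v) (mem_univ w)⟩, h1⟩

theorem argProb_indepProb {α : Type*} [Fintype α] [DecidableEq α] (x : α → ℝ) (a : α) :
    argProb (indepProb x) a = x a := by
  have key := sum_prod_mul_prod_sdiff x (Function.update (fun b => 1 - x b) a 0)
  rw [argProb, sum_filter]
  calc _ = ∑ w : Finset α, (∏ b ∈ w, x b) *
        ∏ b ∈ univ \ w, Function.update (fun b => 1 - x b) a 0 b := by
        refine sum_congr rfl fun w _ => ?_
        split_ifs with h
        · rw [indepProb]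
          congr 1
          refine prod_congr rfl fun b hb => ?_
          have hne : b ≠ a := by rintro rfl; simp_all
          rw [Function.update_of_ne hne]
        · rw [prod_eq_zero (s := univ \ w) (i := a) (by simpa using h) (Function.update_self ..),
            mul_zero]
    _ = x a := by
        rw [key, prod_eq_single a]
        · simp
        · intro b _ hne
          simp [Function.update_of_ne hne]
        · simp

theorem exists_feas_forall_sum_le (n m : ℕ) (c : Fin m → Fin n → ℝ) (c₀ : Fin m → ℝ) :
    ∃ p : (Fin n → ℝ) × (Fin m → ℝ), Feas n m c c₀ p ∧
      ∀ q : (Fin n → ℝ) × (Fin m → ℝ), Feas n m c c₀ q → ∑ j, p.2 j ≤ ∑ j, q.2 j := by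
  obtain ⟨x, hx, hmin⟩ := (isCompact_Icc (a := (0 : Fin n → ℝ)) (b := 1)).exists_isMinOn
    ⟨0, by simp⟩ (f := fun x => ∑ j, max 0 (∑ i, c j i * x i - c₀ j)) (by fun_prop)
  refine ⟨(x, fun j => max 0 (∑ i, c j i * x i - c₀ j)),
    ⟨fun i => ⟨hx.1 i, hx.2 i⟩, fun j => le_max_left _ _, fun j => ?_⟩, fun q hq => ?_⟩
  · have := le_max_right 0 (∑ i, c j i * x i - c₀ j)
    dsimp only
    linarith
  · refine (hmin (show q.1 ∈ Set.Icc 0 1 from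
      ⟨fun i => (hq.1 i).1, fun i => (hq.1 i).2⟩)).trans (sum_le_sum fun j _ => ?_)
    exact max_le (hq.2.1 j) (by linarith [hq.2.2 j])

/-- For the linear program minimizing `∑ⱼ sⱼ` over the feasible region, the feasible region
is nonempty, the minimum is attained and nonnegative, and it equals `0` iff the constraint
set `𝒞` is satisfiable by a probability function. -/
theorem stmt5 {α : Type*} [Fintype α] [DecidableEq α] (n m : ℕ)
    (A : Fin n → α) (hA : Function.Bijective A)
    (c : Fin m → Fin n → ℝ) (c₀ : Fin m → ℝ) :
    ∃ p : (Fin n → ℝ) × (Fin m → ℝ), Feas n m c c₀ p ∧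
      (∀ q : (Fin n → ℝ) × (Fin m → ℝ), Feas n m c c₀ q → ∑ j, p.2 j ≤ ∑ j, q.2 j) ∧
      0 ≤ ∑ j, p.2 j ∧
      ((∑ j, p.2 j = 0) ↔
        ∃ P : Finset α → ℝ, IsProbFun P ∧
          ∀ j : Fin m, ∑ i, c j i * argProb P (A i) ≤ c₀ j) := by
  obtain ⟨p, hp, hmin⟩ := exists_feas_forall_sum_le n m c c₀
  have hnonneg : 0 ≤ ∑ j, p.2 j := sum_nonneg fun j _ => hp.2.1 j
  refine ⟨p, hp, hmin, hnonneg, fun h => ?_, ?_⟩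
  · have hs : ∀ j, p.2 j = 0 := fun j =>
      (sum_eq_zero_iff_of_nonneg fun j _ => hp.2.1 j).1 h j (mem_univ j)
    let e := Equiv.ofBijective A hA
    refine ⟨indepProb (p.1 ∘ e.symm), isProbFun_indepProb fun a => hp.1 _, fun j => ?_⟩
    have he : ∀ i, e.symm (A i) = i := e.symm_apply_apply
    simpa [argProb_indepProb, he, hs] using hp.2.2 j
  · rintro ⟨P, hP, hc⟩
    refine le_antisymm ?_ hnonneg
    simpa using hmin (fun i => argProb P (A i), 0)
      ⟨fun i => ⟨hP.argProb_nonneg _, hP.argProb_le_one _⟩, fun j => le_rfl,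
        fun j => by simpa using hc j⟩
end

section
/- Let 𝒜 be a finite set of arguments, let L : 𝒜 → [0,1] be a probability labelling with associated product probability function P_L(w) = ∏_{A ∈ w} L(A) · ∏_{A ∈ 𝒜 \ w} (1 − L(A)), and let P be any probability function over 𝒜 with P(A) = L(A) for all A ∈ 𝒜. Then H(L) − H(P) = KL(P, P_L) ≥ 0, and equality H(P) = H(L) holds if and only if P = P_L. Consequently, P_L is the unique probability function of maximal entropy among all probability functions P′ with P′(A) = L(A) for all A ∈ 𝒜. -/
open Finset

/-- The product probability function `P_L` associated with a probability labelling `L`. -/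
def prodFun {α : Type*} [Fintype α] [DecidableEq α] (L : α → ℝ) (w : Finset α) : ℝ :=
  (∏ a ∈ w, L a) * ∏ a ∈ wᶜ, (1 - L a)

/-- The entropy of a probability function (with `0·log 0 = 0`, as `Real.log 0 = 0`). -/
noncomputable def entP {α : Type*} [Fintype α] [DecidableEq α] (P : Finset α → ℝ) : ℝ :=
  -∑ w : Finset α, P w * Real.log (P w)

/-- The entropy of a probability labelling. -/
noncomputable def entL {α : Type*} [Fintype α] (L : α → ℝ) : ℝ :=
  ∑ a : α, (-(L a * Real.log (L a)) - (1 - L a) * Real.log (1 - L a))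

/-- The Kullback–Leibler divergence of `P` from `Q` (with the standard conventions for
zero probabilities, which hold since `Real.log 0 = 0` and `x / 0 = 0`). -/
noncomputable def KLdiv {α : Type*} [Fintype α] [DecidableEq α] (P Q : Finset α → ℝ) : ℝ :=
  ∑ w : Finset α, P w * Real.log (P w / Q w)

theorem prodFun_nonneg {α : Type*} [Fintype α] [DecidableEq α] {L : α → ℝ}
    (hL : ∀ a, 0 ≤ L a ∧ L a ≤ 1) (w : Finset α) : 0 ≤ prodFun L w :=
  mul_nonneg (prod_nonneg fun a _ => (hL a).1)
    (prod_nonneg fun a _ => sub_nonneg.2 (hL a).2)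

theorem sum_prodFun {α : Type*} [Fintype α] [DecidableEq α] (L : α → ℝ) :
    ∑ w : Finset α, prodFun L w = 1 := by
  simp only [prodFun]
  rw [← Fintype.prod_add]
  simp

theorem isProbFun_prodFun {α : Type*} [Fintype α] [DecidableEq α] {L : α → ℝ}
    (hL : ∀ a, 0 ≤ L a ∧ L a ≤ 1) : IsProbFun (prodFun L) := by
  refine ⟨fun w => ⟨prodFun_nonneg hL w, ?_⟩, sum_prodFun L⟩
  rw [← sum_prodFun L]
  exact single_le_sum (fun v _ => prodFun_nonneg hL v) (mem_univ w)

theorem argProb_prodFun {α : Type*} [Fintype α] [DecidableEq α] (L : α → ℝ) (a : α) :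
    argProb (prodFun L) a = L a := by
  have key := Fintype.prod_add L (Function.update (fun b => 1 - L b) a 0)
  have hprod : ∏ b, (L b + Function.update (fun b => 1 - L b) a 0 b) = L a := by
    rw [Fintype.prod_eq_single a]
    · simp
    · intro b hb
      simp [hb]
  rw [← hprod, key, argProb, sum_filter]
  refine sum_congr rfl fun w _ => ?_
  split_ifs with h
  · rw [prodFun]
    congr 1
    refine prod_congr rfl fun b hb => ?_
    rw [Function.update_of_ne]
    rintro rfl
    exact mem_compl.1 hb h
  · rw [prod_eq_zero (mem_compl.2 h) (by simp), mul_zero]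

theorem sum_filter_notMem_eq {α : Type*} [Fintype α] [DecidableEq α] {P : Finset α → ℝ}
    (hP : IsProbFun P) (a : α) :
    ∑ w ∈ univ.filter (fun w : Finset α => a ∉ w), P w = 1 - argProb P a := by
  rw [← hP.2, argProb, ← sum_filter_add_sum_filter_not univ (fun w : Finset α => a ∈ w) P]
  ring

theorem factors_pos_of_pos {α : Type*} [Fintype α] [DecidableEq α] {L : α → ℝ}
    {P : Finset α → ℝ} (hP : IsProbFun P) (hPL : ∀ a, argProb P a = L a) {w : Finset α}
    (hw : 0 < P w) : (∀ a ∈ w, 0 < L a) ∧ ∀ a ∈ wᶜ, 0 < 1 - L a := by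
  refine ⟨fun a ha => ?_, fun a ha => ?_⟩
  · rw [← hPL a]
    exact hw.trans_le (single_le_sum (f := P) (fun v _ => (hP.1 v).1) (by simpa using ha))
  · rw [← hPL a, ← sum_filter_notMem_eq hP]
    exact hw.trans_le (single_le_sum (f := P) (fun v _ => (hP.1 v).1) (by simpa using ha))

theorem prodFun_pos_of_pos {α : Type*} [Fintype α] [DecidableEq α] {L : α → ℝ}
    {P : Finset α → ℝ} (hP : IsProbFun P) (hPL : ∀ a, argProb P a = L a) {w : Finset α}
    (hw : 0 < P w) : 0 < prodFun L w :=
  mul_pos (prod_pos (factors_pos_of_pos hP hPL hw).1) (prod_pos (factors_pos_of_pos hP hPL hw).2)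

/-- The cross entropy of `P` relative to `prodFun L` is the entropy of `L`. -/
theorem sum_mul_log_prodFun {α : Type*} [Fintype α] [DecidableEq α] {L : α → ℝ}
    {P : Finset α → ℝ} (hP : IsProbFun P) (hPL : ∀ a, argProb P a = L a) :
    ∑ w : Finset α, P w * Real.log (prodFun L w) = -entL L := by
  have hlog : ∀ w, P w * Real.log (prodFun L w) =
      ∑ a, ((if a ∈ w then P w else 0) * Real.log (L a) +
        (if a ∉ w then P w else 0) * Real.log (1 - L a)) := by
    intro w
    rcases (hP.1 w).1.eq_or_lt with h0 | hw
    · simp [← h0]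
    · obtain ⟨h1, h2⟩ := factors_pos_of_pos hP hPL hw
      rw [prodFun, Real.log_mul (prod_pos h1).ne' (prod_pos h2).ne',
        Real.log_prod fun a ha => (h1 a ha).ne', Real.log_prod fun a ha => (h2 a ha).ne',
        mul_add, mul_sum, mul_sum, sum_add_distrib]
      simp only [ite_mul, zero_mul, ← sum_filter]
      congr 2 <;> ext a <;> simp
  rw [sum_congr rfl fun w _ => hlog w, sum_comm, entL, ← sum_neg_distrib]
  refine sum_congr rfl fun a _ => ?_
  rw [sum_add_distrib, ← sum_mul, ← sum_mul, ← sum_filter, ← sum_filter,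
    sum_filter_notMem_eq hP, ← argProb, hPL]
  ring

theorem entL_sub_entP_eq_KLdiv {α : Type*} [Fintype α] [DecidableEq α] {L : α → ℝ}
    {P : Finset α → ℝ} (hP : IsProbFun P) (hPL : ∀ a, argProb P a = L a) :
    entL L - entP P = KLdiv P (prodFun L) := by
  have h : KLdiv P (prodFun L) =
      ∑ w, (P w * Real.log (P w) - P w * Real.log (prodFun L w)) := by
    refine sum_congr rfl fun w _ => ?_
    rcases (hP.1 w).1.eq_or_lt with h0 | hw
    · simp [← h0]
    · rw [Real.log_div hw.ne' (prodFun_pos_of_pos hP hPL hw).ne', mul_sub]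
  rw [h, sum_sub_distrib, sum_mul_log_prodFun hP hPL, entP]
  ring

theorem sub_lt_mul_log_div {p q : ℝ} (hp : 0 ≤ p) (hq : 0 ≤ q) (hpq : 0 < p → 0 < q)
    (hne : p ≠ q) : p - q < p * Real.log (p / q) := by
  rcases hp.eq_or_lt with rfl | hp
  · simpa using lt_of_le_of_ne hq hne
  · have hlt := mul_lt_mul_of_pos_left (Real.log_lt_sub_one_of_pos (div_pos (hpq hp) hp)
      fun h => hne ((div_eq_one_iff_eq hp.ne').1 h).symm) hp
    rw [mul_sub, mul_div_cancel₀ _ hp.ne', ← inv_div, Real.log_inv] at hlt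
    linarith

theorem sub_le_mul_log_div {p q : ℝ} (hp : 0 ≤ p) (hq : 0 ≤ q) (hpq : 0 < p → 0 < q) :
    p - q ≤ p * Real.log (p / q) := by
  rcases eq_or_ne p q with rfl | hne
  · rcases eq_or_ne p 0 with rfl | h <;> simp [*]
  · exact (sub_lt_mul_log_div hp hq hpq hne).le

theorem KLdiv_nonneg {α : Type*} [Fintype α] [DecidableEq α] {P Q : Finset α → ℝ}
    (hP : IsProbFun P) (hQ : IsProbFun Q) (hPQ : ∀ w, 0 < P w → 0 < Q w) :
    0 ≤ KLdiv P Q := by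
  have h : ∑ w, (P w - Q w) ≤ KLdiv P Q :=
    sum_le_sum fun w _ => sub_le_mul_log_div (hP.1 w).1 (hQ.1 w).1 (hPQ w)
  rwa [sum_sub_distrib, hP.2, hQ.2, sub_self] at h

theorem eq_of_KLdiv_eq_zero {α : Type*} [Fintype α] [DecidableEq α] {P Q : Finset α → ℝ}
    (hP : IsProbFun P) (hQ : IsProbFun Q) (hPQ : ∀ w, 0 < P w → 0 < Q w)
    (h : KLdiv P Q = 0) : P = Q := by
  by_contra hne
  obtain ⟨v, hv⟩ := Function.ne_iff.1 hne
  have hlt : ∑ w, (P w - Q w) < KLdiv P Q :=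
    sum_lt_sum (fun w _ => sub_le_mul_log_div (hP.1 w).1 (hQ.1 w).1 (hPQ w))
      ⟨v, mem_univ v, sub_lt_mul_log_div (hP.1 v).1 (hQ.1 v).1 (hPQ v) hv⟩
  rw [sum_sub_distrib, hP.2, hQ.2, sub_self, h] at hlt
  exact lt_irrefl _ hlt

theorem entP_prodFun {α : Type*} [Fintype α] [DecidableEq α] {L : α → ℝ}
    (hL : ∀ a, 0 ≤ L a ∧ L a ≤ 1) : entP (prodFun L) = entL L := by
  rw [entP, sum_mul_log_prodFun (isProbFun_prodFun hL) (argProb_prodFun L), neg_neg]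

/-- For any probability function `P` that is atomically equivalent to the labelling `L`
(i.e. `P(A) = L(A)` for all arguments `A`), we have `H(L) − H(P) = KL(P, P_L) ≥ 0`, with
`H(P) = H(L)` iff `P = P_L`.  Consequently `P_L` is the unique entropy maximizer among all
probability functions inducing the labelling `L`. -/
theorem stmt8 {α : Type*} [Fintype α] [DecidableEq α]
    (L : α → ℝ) (hL : ∀ a, 0 ≤ L a ∧ L a ≤ 1)
    (P : Finset α → ℝ) (hP : IsProbFun P) (hPL : ∀ a : α, argProb P a = L a) :
    entL L - entP P = KLdiv P (prodFun L) ∧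
    0 ≤ KLdiv P (prodFun L) ∧
    (entP P = entL L ↔ P = prodFun L) ∧
    (∀ P' : Finset α → ℝ, IsProbFun P' → (∀ a : α, argProb P' a = L a) →
      entP P' ≤ entP (prodFun L) ∧ (entP P' = entP (prodFun L) → P' = prodFun L)) := by
  have hQ := isProbFun_prodFun hL
  have hnonneg : ∀ P' : Finset α → ℝ, IsProbFun P' → (∀ a, argProb P' a = L a) →
      0 ≤ KLdiv P' (prodFun L) := fun P' hP' hPL' =>
    KLdiv_nonneg hP' hQ fun w => prodFun_pos_of_pos hP' hPL'
  have heq : ∀ P' : Finset α → ℝ, IsProbFun P' → (∀ a, argProb P' a = L a) →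
      entP P' = entL L → P' = prodFun L := fun P' hP' hPL' h =>
    eq_of_KLdiv_eq_zero hP' hQ (fun w => prodFun_pos_of_pos hP' hPL')
      (by rw [← entL_sub_entP_eq_KLdiv hP' hPL', h, sub_self])
  refine ⟨entL_sub_entP_eq_KLdiv hP hPL, hnonneg P hP hPL, ⟨heq P hP hPL, ?_⟩, ?_⟩
  · rintro rfl
    exact entP_prodFun hL
  · intro P' hP' hPL'
    rw [entP_prodFun hL]
    refine ⟨?_, heq P' hP' hPL'⟩
    rw [← sub_nonneg, entL_sub_entP_eq_KLdiv hP' hPL']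
    exact hnonneg P' hP' hPL'
end

section
/- Let 𝒜 be a finite set of arguments, let L : 𝒜 → [0,1] be a probability labelling with associated product probability function P_L(w) = ∏_{A ∈ w} L(A) · ∏_{A ∈ 𝒜 \ w} (1 − L(A)), and let A, B ∈ 𝒜 be distinct arguments such that the support-coherence condition P_L(B) ≥ P_L(A) holds. Then for every conjunction χ of arguments from 𝒜, P_L(A ∧ ¬B ∧ χ) ≤ min{0.25, 1 − P_L(A)}. -/
open Finset

/-- The probability of an event under a probability function. -/
def eventProb {α : Type*} [Fintype α] [DecidableEq α] (P : Finset α → ℝ)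
    (E : Finset α → Prop) [DecidablePred E] : ℝ :=
  ∑ w ∈ univ.filter E, P w

/-- Under `P_L` the literals over distinct arguments are independent. -/
theorem sum_prodFun_filter {α : Type*} [Fintype α] [DecidableEq α]
    (L : α → ℝ) {T U : Finset α} (hTU : Disjoint T U) :
    ∑ w ∈ univ.filter (fun w : Finset α => T ⊆ w ∧ Disjoint U w), prodFun L w =
      (∏ a ∈ T, L a) * ∏ a ∈ U, (1 - L a) := by
  have key := Fintype.prod_add (fun a => if a ∈ U then 0 else L a)
    (fun a => if a ∈ T then 0 else 1 - L a)
  have factor : ∀ a, (if a ∈ U then 0 else L a) + (if a ∈ T then 0 else 1 - L a) =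
      (if a ∈ T then L a else 1) * (if a ∈ U then 1 - L a else 1) := by
    intro a
    by_cases hT : a ∈ T
    · simp [hT, disjoint_left.1 hTU hT]
    · by_cases hU : a ∈ U <;> simp [hT, hU]
  simp only [factor, prod_mul_distrib, prod_ite_mem, univ_inter] at key
  rw [key, sum_filter]
  refine sum_congr rfl fun w _ => ?_
  split_ifs with h
  · refine congrArg₂ (· * ·) (prod_congr rfl fun a ha => ?_) (prod_congr rfl fun a ha => ?_)
    · rw [if_neg (disjoint_right.1 h.2 ha)]
    · rw [if_neg fun hT => mem_compl.1 ha (h.1 hT)]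
  · symm
    by_cases hT : T ⊆ w
    · obtain ⟨a, haU, haw⟩ := not_disjoint_iff.1 fun hd => h ⟨hT, hd⟩
      refine mul_eq_zero_of_left (prod_eq_zero haw ?_) _
      exact if_pos haU
    · obtain ⟨a, haT, haw⟩ := not_subset.1 hT
      exact mul_eq_zero_of_right _ (prod_eq_zero (mem_compl.2 haw) (if_pos haT))

/-- If the support-coherence condition `P_L(B) ≥ P_L(A)` holds for distinct arguments
`A, B`, then for every conjunction `χ = ⋀_{a ∈ S} a` of arguments,
`P_L(A ∧ ¬B ∧ χ) ≤ min {0.25, 1 − P_L(A)}`. -/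
theorem stmt13 {α : Type*} [Fintype α] [DecidableEq α]
    (L : α → ℝ) (hL : ∀ a, 0 ≤ L a ∧ L a ≤ 1)
    (A B : α) (hAB : A ≠ B)
    (hSCoh : argProb (prodFun L) A ≤ argProb (prodFun L) B)
    (S : Finset α) :
    eventProb (prodFun L) (fun w => A ∈ w ∧ B ∉ w ∧ S ⊆ w)
      ≤ min (0.25 : ℝ) (1 - argProb (prodFun L) A) := by
  have hle : eventProb (prodFun L) (fun w => A ∈ w ∧ B ∉ w ∧ S ⊆ w) ≤ L A * (1 - L B) := by
    have h := sum_prodFun_filter L (disjoint_singleton.2 hAB)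
    simp only [singleton_subset_iff, disjoint_singleton_left, prod_singleton] at h
    rw [← h]
    exact sum_le_sum_of_subset_of_nonneg
      (monotone_filter_right _ fun w _ hw => ⟨hw.1, hw.2.1⟩) fun w _ _ => prodFun_nonneg hL w
  simp only [argProb_prodFun] at hSCoh ⊢
  have hA := hL A
  refine hle.trans ((mul_le_mul_of_nonneg_left (sub_le_sub_left hSCoh 1) hA.1).trans ?_)
  refine le_min ?_ ?_
  · nlinarith [sq_nonneg (L A - 1 / 2)]
  · exact mul_le_of_le_one_left (sub_nonneg.2 hA.2) hA.2
end

section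
/- Let 𝒜 be a finite set of arguments, let F₁,…,F_m be propositional formulas over 𝒜, and let 𝒞 be a set of m linear constraints, where the j-th constraint has the form ∑_i c⁽ʲ⁾_i·π(F_i) ≤ c⁽ʲ⁾₀ with real coefficients. If some probability function over 𝒜 satisfies all constraints in 𝒞, then there exists a probability function P* over 𝒜 satisfying all constraints in 𝒞 such that P* assigns non-zero probability to at most m + 1 possible worlds, i.e. |{w ⊆ 𝒜 : P*(w) > 0}| ≤ m + 1. -/
open Finset

/-- Propositional formulas over a set of arguments, with arguments as atoms and the
usual connectives. -/
inductive Form (α : Type*) where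
  | atom : α → Form α
  | neg  : Form α → Form α
  | conj : Form α → Form α → Form α
  | disj : Form α → Form α → Form α

/-- Satisfaction of a formula by a possible world `w` (a subset of arguments): an atom `A`
is satisfied iff `A ∈ w`, and the connectives are interpreted as usual. -/
def Form.eval {α : Type*} [DecidableEq α] (w : Finset α) : Form α → Bool
  | .atom a => decide (a ∈ w)
  | .neg f => !f.eval w
  | .conj f g => f.eval w && g.eval w
  | .disj f g => f.eval w || g.eval w

/-- The probability of a formula under a probability function: the sum of the
probabilities of all worlds satisfying the formula. -/
def formProb {α : Type*} [Fintype α] [DecidableEq α] (P : Finset α → ℝ) (F : Form α) : ℝ :=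
  ∑ w ∈ univ.filter (fun w : Finset α => F.eval w), P w

/-- **Carathéodory's theorem** for weights: a convex combination of finitely many points in a
finite-dimensional space equals one with at most `finrank + 1` positive weights. -/
theorem exists_sparse_convex_weights {ι E : Type*} [Fintype ι] [DecidableEq ι]
    [AddCommGroup E] [Module ℝ E] [FiniteDimensional ℝ E] (v : ι → E) (p : ι → ℝ)
    (hp : ∀ i, 0 ≤ p i) (hp1 : ∑ i, p i = 1) :
    ∃ q : ι → ℝ, (∀ i, 0 ≤ q i) ∧ ∑ i, q i = 1 ∧ ∑ i, q i • v i = ∑ i, p i • v i ∧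
      (univ.filter (fun i => 0 < q i)).card ≤ Module.finrank ℝ E + 1 := by
  have hmem : ∑ i, p i • v i ∈ convexHull ℝ (Set.range v) :=
    (convex_convexHull ℝ _).sum_mem (fun i _ => hp i) hp1
      (fun i _ => subset_convexHull ℝ _ (Set.mem_range_self i))
  obtain ⟨κ, _, z, r, hz, hind, hr, hr1, hsum⟩ := eq_pos_convex_span_of_mem_convexHull hmem
  choose g hg using fun k => hz (Set.mem_range_self k)
  refine ⟨fun i => ∑ k with g k = i, r k, fun i => sum_nonneg fun k _ => (hr k).le, ?_, ?_, ?_⟩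
  · rw [sum_fiberwise, hr1]
  · rw [← hsum, ← sum_fiberwise univ g (fun k => r k • z k)]
    refine sum_congr rfl fun i _ => ?_
    rw [sum_smul]
    refine sum_congr rfl fun k hk => ?_
    rw [← hg k, (mem_filter.mp hk).2]
  · have hsub : univ.filter (fun i => 0 < ∑ k with g k = i, r k) ⊆ univ.image g := by
      intro i hi
      obtain ⟨k, hk, -⟩ := exists_ne_zero_of_sum_ne_zero (mem_filter.mp hi).2.ne'
      exact mem_image.mpr ⟨k, mem_univ k, (mem_filter.mp hk).2⟩
    calc _ ≤ (univ.image g).card := card_le_card hsub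
      _ ≤ Fintype.card κ := card_image_le
      _ ≤ Module.finrank ℝ (vectorSpan ℝ (Set.range z)) + 1 := hind.card_le_finrank_succ
      _ ≤ Module.finrank ℝ E + 1 := by gcongr; exact Submodule.finrank_le _

/-- A linear combination of formula probabilities is linear in the probabilities of worlds. -/
theorem sum_mul_formProb {α κ : Type*} [Fintype α] [DecidableEq α] [Fintype κ]
    (P : Finset α → ℝ) (F : κ → Form α) (a : κ → ℝ) :
    ∑ i, a i * formProb P (F i) = ∑ w, P w * ∑ i, if (F i).eval w then a i else 0 := by
  simp only [formProb, sum_filter, mul_sum]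
  rw [sum_comm]
  refine sum_congr rfl fun w _ => sum_congr rfl fun i _ => ?_
  split_ifs <;> ring

/-- If a set of `m` linear constraints over formulas `F₁,…,F_t` (the `j`-th being
`∑ᵢ c⁽ʲ⁾ᵢ·π(Fᵢ) ≤ c⁽ʲ⁾₀`) is satisfiable by a probability function, then it is satisfiable
by a probability function `P*` assigning non-zero probability to at most `m + 1` possible
worlds. -/
theorem stmt15 {α : Type*} [Fintype α] [DecidableEq α] (t m : ℕ)
    (F : Fin t → Form α) (c : Fin m → Fin t → ℝ) (c₀ : Fin m → ℝ)
    (hsat : ∃ P : Finset α → ℝ, IsProbFun P ∧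
      ∀ j : Fin m, ∑ i, c j i * formProb P (F i) ≤ c₀ j) :
    ∃ P : Finset α → ℝ, IsProbFun P ∧
      (∀ j : Fin m, ∑ i, c j i * formProb P (F i) ≤ c₀ j) ∧
      (univ.filter (fun w : Finset α => 0 < P w)).card ≤ m + 1 := by
  obtain ⟨P, ⟨hP, hP1⟩, hc⟩ := hsat
  obtain ⟨Q, hQ, hQ1, hQP, hcard⟩ := exists_sparse_convex_weights
    (fun (w : Finset α) (j : Fin m) => ∑ i, if (F i).eval w then c j i else 0) P
    (fun w => (hP w).1) hP1
  refine ⟨Q, ⟨fun w => ⟨hQ w, ?_⟩, hQ1⟩, fun j => ?_, by simpa using hcard⟩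
  · rw [← hQ1]
    exact single_le_sum (fun w _ => hQ w) (mem_univ w)
  · have hj := congrFun hQP j
    simp only [Finset.sum_apply, Pi.smul_apply, smul_eq_mul] at hj
    rw [sum_mul_formProb, hj, ← sum_mul_formProb]
    exact hc j
end
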